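/- Let $\Lambda=\mathbb{Z}_p[[x]]$, $Z$ a finitely generated torsion $\Lambda$-module with elementary $\mu$-invariants $p^{\alpha_1},\dots,p^{\alpha_m}$, and for integers $\nu, n\geq 1$ let $\mathscr{J}_{\nu,n}$ be the ideal generated by $p^\nu$ and $(x+1)^{p^n}-1$. Then $\log_p |Z/\mathscr{J}_{\nu,n} Z| = p^n\cdot\sum_{i=1}^m \min\{\nu,\alpha_i\} + O(1)$ as $n\to\infty$ ($\nu$ fixed). -/

import Mathlib

open PowerSeries

theorem card_basic {p : ℕ} [Fact p.Prime] (g : PowerSeries ℤ_[p])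
    (hg : g.map (IsLocalRing.residue ℤ_[p]) ≠ 0) (c : ℕ) :
    Nat.card (PowerSeries ℤ_[p] ⧸ Ideal.span {(p : PowerSeries ℤ_[p]) ^ c, g}) =
      p ^ (c * (g.map (IsLocalRing.residue ℤ_[p])).order.toNat) := by
  obtain ⟨f, h, H⟩ := g.exists_isWeierstrassFactorization hg
  rw [← H.natDegree_eq_toNat_order_map]
  have hm : f.Monic := H.isDistinguishedAt.monic
  let e : (PowerSeries ℤ_[p] ⧸ Ideal.span {g}) ≃ₗ[ℤ_[p]] (Fin f.natDegree → ℤ_[p]) :=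
    (H.algEquivQuotient.symm.toLinearEquiv).trans (AdjoinRoot.powerBasis' hm).basis.equivFun
  let φ : PowerSeries ℤ_[p] →+ (Fin f.natDegree → ZMod (p ^ c)) :=
    ((PadicInt.toZModPow c).toAddMonoidHom.compLeft (Fin f.natDegree)).comp
      (e.toLinearMap.toAddMonoidHom.comp (Ideal.Quotient.mk (Ideal.span {g})).toAddMonoidHom)
  have hφ : ∀ x i, φ x i = PadicInt.toZModPow c (e (Ideal.Quotient.mk _ x) i) := fun _ _ => rfl
  have hs : Function.Surjective φ := by
    intro y
    have : ∀ i, ∃ a : ℤ_[p], PadicInt.toZModPow c a = y i := fun i =>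
      ZMod.ringHom_surjective _ _
    choose a ha using this
    obtain ⟨x, hx⟩ := Ideal.Quotient.mk_surjective (e.symm a)
    refine ⟨x, ?_⟩
    ext i
    rw [hφ, hx, e.apply_symm_apply, ha]
  have hk : φ.ker = (Ideal.span {(p : PowerSeries ℤ_[p]) ^ c, g}).toAddSubgroup := by
    ext x
    have h1 : x ∈ φ.ker ↔ ∀ i, PadicInt.toZModPow c (e (Ideal.Quotient.mk _ x) i) = 0 := by
      rw [AddMonoidHom.mem_ker, funext_iff]; rfl
    rw [h1, Submodule.mem_toAddSubgroup, Ideal.mem_span_pair]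
    have h2 : ∀ a : ℤ_[p], PadicInt.toZModPow c a = 0 ↔ ∃ b, a = (p : ℤ_[p]) ^ c * b := by
      intro a
      rw [← RingHom.mem_ker, PadicInt.ker_toZModPow, Ideal.mem_span_singleton]; rfl
    have h3 : ∀ z : PowerSeries ℤ_[p], Ideal.Quotient.mk (Ideal.span {g}) ((p : PowerSeries ℤ_[p]) ^ c * z)
        = ((p : ℤ_[p]) ^ c) • Ideal.Quotient.mk (Ideal.span {g}) z := by
      intro z
      rw [← Nat.cast_pow, ← Nat.cast_pow, Nat.cast_smul_eq_nsmul, nsmul_eq_mul, map_mul, map_natCast]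
    simp only [h2]
    constructor
    · intro hx
      choose b hb using hx
      obtain ⟨z, hz⟩ := Ideal.Quotient.mk_surjective (e.symm b)
      have h4 : Ideal.Quotient.mk (Ideal.span {g}) x =
          Ideal.Quotient.mk (Ideal.span {g}) ((p : PowerSeries ℤ_[p]) ^ c * z) := by
        apply e.injective
        rw [h3, map_smul, hz, e.apply_symm_apply]
        ext i
        simpa using hb i
      rw [Ideal.Quotient.eq, Ideal.mem_span_singleton'] at h4
      obtain ⟨w, hw⟩ := h4
      exact ⟨z, w, by rw [hw]; ring⟩
    · rintro ⟨z, w, rfl⟩ i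
      refine ⟨e (Ideal.Quotient.mk _ z) i, ?_⟩
      have : Ideal.Quotient.mk (Ideal.span {g}) (z * (p : PowerSeries ℤ_[p]) ^ c + w * g) =
          Ideal.Quotient.mk (Ideal.span {g}) ((p : PowerSeries ℤ_[p]) ^ c * z) := by
        rw [Ideal.Quotient.eq, Ideal.mem_span_singleton']
        exact ⟨w, by ring⟩
      rw [this, h3, map_smul]; simp
  have e2 := QuotientAddGroup.quotientKerEquivOfSurjective φ hs
  have := Nat.card_congr e2.toEquiv
  rw [hk] at this
  refine Eq.trans this ?_
  simp [← pow_mul]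

theorem map_ne_of_not_dvd {p : ℕ} [Fact p.Prime] (g : PowerSeries ℤ_[p])
    (hg : ¬ (p : PowerSeries ℤ_[p]) ∣ g) : g.map (IsLocalRing.residue ℤ_[p]) ≠ 0 := by
  intro h0
  apply hg
  have : ∀ i, ∃ b, coeff i g = (p : ℤ_[p]) * b := by
    intro i
    have : coeff i (g.map (IsLocalRing.residue ℤ_[p])) = 0 := by rw [h0]; simp
    rw [PowerSeries.coeff_map, IsLocalRing.residue_eq_zero_iff, PadicInt.maximalIdeal_eq_span_p,
      Ideal.mem_span_singleton] at this
    exact this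
  choose b hb using this
  refine ⟨PowerSeries.mk b, ?_⟩
  ext i
  have : (p : PowerSeries ℤ_[p]) = C (p : ℤ_[p]) := by simp
  rw [this, coeff_C_mul, coeff_mk, hb]

theorem map_omega {p : ℕ} [Fact p.Prime] (n : ℕ) :
    (((PowerSeries.X : PowerSeries ℤ_[p]) + 1) ^ (p ^ n) - 1).map (IsLocalRing.residue ℤ_[p])
      = X ^ (p ^ n) := by
  have h0 : (p : IsLocalRing.ResidueField ℤ_[p]) = 0 := by
    have := (IsLocalRing.residue_eq_zero_iff (p : ℤ_[p])).2 (by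
      rw [PadicInt.maximalIdeal_eq_span_p]; exact Ideal.mem_span_singleton_self _)
    simpa using this
  have : CharP (IsLocalRing.ResidueField ℤ_[p]) p :=
    (CharP.charP_iff_prime_eq_zero Fact.out).2 h0
  have : CharP (PowerSeries (IsLocalRing.ResidueField ℤ_[p])) p :=
    (CharP.charP_iff_prime_eq_zero Fact.out).2 (by
      have : (p : PowerSeries (IsLocalRing.ResidueField ℤ_[p])) = C (p : IsLocalRing.ResidueField ℤ_[p]) := (map_natCast _ p).symm
      rw [this, h0, map_zero])
  simp [add_pow_char_pow]

theorem card_tensor_quot {R : Type*} [CommRing R] (I J : Ideal R) :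
    Nat.card (TensorProduct R (R ⧸ J) (R ⧸ I)) = Nat.card (R ⧸ (I ⊔ J)) := by
  rw [Nat.card_congr (TensorProduct.quotTensorEquivQuotSMul (R ⧸ I) J).toEquiv]
  have : (J • ⊤ : Submodule R (R ⧸ I)) = Submodule.map (Submodule.mkQ I) J := by
    conv_rhs => rw [← Ideal.mul_top J, ← smul_eq_mul, Submodule.map_smul'', Submodule.map_top,
      Submodule.range_mkQ]
  rw [this]
  exact Nat.card_congr (Submodule.quotientQuotientEquivQuotientSup I J).toEquiv

/-- Counting. -/
theorem count {R Z M : Type*} [CommRing R] [AddCommGroup Z] [Module R Z] [AddCommGroup M]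
    [Module R M] (f : M →ₗ[R] Z) (hinj : Function.Injective f)
    [hN : Finite (Z ⧸ LinearMap.range f)] (a b : R)  :
    ∃ D : ℕ, 1 ≤ D ∧ D ≤ Nat.card (Z ⧸ LinearMap.range f) ^ 2 ∧
      D * Nat.card (Z ⧸ (Ideal.span {a, b} • (⊤ : Submodule R Z))) =
      Nat.card (M ⧸ (Ideal.span {a, b} • (⊤ : Submodule R M))) *
        Nat.card (Z ⧸ LinearMap.range f) := by
  set J := Ideal.span {a, b} with hJ
  let T : Submodule R Z := J • LinearMap.range f
  have h1 := Submodule.card_quotient_mul_card_quotient (LinearMap.range f) T Submodule.smul_le_right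
  have h2 := Submodule.card_quotient_mul_card_quotient (J • (⊤ : Submodule R Z)) T
    (Submodule.smul_mono le_rfl le_top)
  have h3 : Nat.card ((LinearMap.range f).map T.mkQ) = Nat.card (M ⧸ (J • (⊤ : Submodule R M))) := by
    rw [← LinearMap.range_comp]
    have hk : LinearMap.ker (T.mkQ ∘ₗ f) = J • ⊤ := by
      rw [LinearMap.ker_comp, Submodule.ker_mkQ]
      have : T = (J • (⊤ : Submodule R M)).map f := by
        rw [Submodule.map_smul'', Submodule.map_top]
      rw [this, Submodule.comap_map_eq_of_injective hinj]
    rw [← hk]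
    exact (Nat.card_congr (T.mkQ ∘ₗ f).quotKerEquivRange.toEquiv).symm
  let ψ : (Z ⧸ LinearMap.range f) × (Z ⧸ LinearMap.range f) →ₗ[R] Z ⧸ T :=
    LinearMap.coprod
      ((LinearMap.range f).mapQ T (a • LinearMap.id) (fun x hx =>
        Submodule.smul_mem_smul (Ideal.subset_span (by simp)) hx))
      ((LinearMap.range f).mapQ T (b • LinearMap.id) (fun x hx =>
        Submodule.smul_mem_smul (Ideal.subset_span (by simp)) hx))
  have hψ : (J • (⊤ : Submodule R Z)).map T.mkQ ≤ LinearMap.range ψ := by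
    rw [Submodule.map_le_iff_le_comap, Submodule.smul_le]
    rintro r hr z -
    rw [hJ, Ideal.mem_span_pair] at hr
    obtain ⟨s, t, rfl⟩ := hr
    refine ⟨(Submodule.Quotient.mk (s • z), Submodule.Quotient.mk (t • z)), ?_⟩
    simp only [ψ, LinearMap.coprod_apply, Submodule.mapQ_apply]
    rw [Submodule.mkQ_apply, ← Submodule.Quotient.mk_add]
    congr 1
    simp only [LinearMap.smul_apply, LinearMap.id_apply, smul_smul, add_smul]
    rw [mul_comm a, mul_comm b]
  have hfin : Finite (LinearMap.range ψ) := Finite.of_surjective _ ψ.surjective_rangeRestrict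
  have hfin2 : Finite ((J • (⊤ : Submodule R Z)).map T.mkQ) :=
    Finite.of_injective _ (Submodule.inclusion_injective hψ)
  refine ⟨Nat.card ((J • (⊤ : Submodule R Z)).map T.mkQ), Nat.card_pos, ?_, ?_⟩
  · calc _ ≤ Nat.card (LinearMap.range ψ) :=
          Nat.card_le_card_of_injective _ (Submodule.inclusion_injective hψ)
      _ ≤ Nat.card ((Z ⧸ LinearMap.range f) × (Z ⧸ LinearMap.range f)) :=
          Nat.card_le_card_of_surjective _ ψ.surjective_rangeRestrict
      _ = _ := by rw [Nat.card_prod, sq]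
  · rw [h2, ← h1, h3]

theorem stmt_15 (p : ℕ) [Fact p.Prime]
    (Z : Type*) [AddCommGroup Z] [Module (PowerSeries ℤ_[p]) Z]
    [Module.Finite (PowerSeries ℤ_[p]) Z]
    (m k : ℕ) (α : Fin m → ℕ) (hα : ∀ i, 0 < α i)
    (β : Fin k → ℕ) (hβ : ∀ j, 0 < β j)
    (η : Fin k → PowerSeries ℤ_[p])
    (hη : ∀ j, Irreducible (η j)) (hηp : ∀ j, ¬ ((p : PowerSeries ℤ_[p]) ∣ η j))
    -- the exact sequence `0 → ⊕ᵢ Λ/(p^{α_i}) ⊕ ⊕ⱼ Λ/(η_j^{β_j}) → Z → N → 0`,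
    -- with `N` pseudo-null, i.e. finite:
    (f : ((Π i : Fin m, PowerSeries ℤ_[p] ⧸
            Ideal.span {(p : PowerSeries ℤ_[p]) ^ (α i)}) ×
          (Π j : Fin k, PowerSeries ℤ_[p] ⧸
            Ideal.span {(η j) ^ (β j)})) →ₗ[PowerSeries ℤ_[p]] Z)
    (hinj : Function.Injective f)
    (hN : Finite (Z ⧸ LinearMap.range f)) :
    ∀ ν : ℕ, 0 < ν → ∃ C : ℕ, ∀ n : ℕ, ∃ e : ℕ,
      Nat.card (Z ⧸ ((Ideal.span {(p : PowerSeries ℤ_[p]) ^ ν,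
          ((PowerSeries.X : PowerSeries ℤ_[p]) + 1) ^ (p ^ n) - 1}) •
          (⊤ : Submodule (PowerSeries ℤ_[p]) Z))) = p ^ e ∧
      |(e : ℤ) - (p : ℤ) ^ n * (∑ i : Fin m, (min ν (α i) : ℤ))| ≤ C := by
  intro ν hν
  have hp : p.Prime := Fact.out
  let N := Nat.card (Z ⧸ LinearMap.range f)
  have hNpos : 0 < N := Nat.card_pos
  let B : ℕ := ∏ j : Fin k, Nat.card (PowerSeries ℤ_[p] ⧸
    Ideal.span {(p : PowerSeries ℤ_[p]) ^ ν, (η j) ^ (β j)})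
  have hfin : ∀ j, Finite (PowerSeries ℤ_[p] ⧸
      Ideal.span {(p : PowerSeries ℤ_[p]) ^ ν, (η j) ^ (β j)}) := by
    intro j
    apply Nat.finite_of_card_ne_zero
    rw [card_basic]
    · exact pow_ne_zero _ hp.ne_zero
    · rw [map_pow]
      exact pow_ne_zero _ (map_ne_of_not_dvd _ (hηp j))
  refine ⟨B * N + N ^ 2, fun n => ?_⟩
  obtain ⟨D, hD1, hD2, hD⟩ := count f hinj ((p : PowerSeries ℤ_[p]) ^ ν)
    (((PowerSeries.X : PowerSeries ℤ_[p]) + 1) ^ (p ^ n) - 1)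
  set ω : PowerSeries ℤ_[p] := ((PowerSeries.X : PowerSeries ℤ_[p]) + 1) ^ (p ^ n) - 1 with hω
  set J := Ideal.span {(p : PowerSeries ℤ_[p]) ^ ν, ω} with hJ
  change D ≤ N ^ 2 at hD2
  change _ = _ * N at hD
  set S := ∑ i : Fin m, min ν (α i) with hS
  have hle : ∀ j, Ideal.span {(p : PowerSeries ℤ_[p]) ^ ν, (η j) ^ (β j)} ≤
      Ideal.span {(η j) ^ (β j)} ⊔ J := by
    intro j
    rw [Ideal.span_le]
    rintro x (rfl | rfl)
    · exact Ideal.mem_sup_right (Ideal.subset_span (by simp))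
    · exact Ideal.mem_sup_left (Ideal.subset_span (by simp))
  have hfin2 : ∀ j, Finite (PowerSeries ℤ_[p] ⧸ (Ideal.span {(η j) ^ (β j)} ⊔ J)) := fun j =>
    have := hfin j
    Finite.of_surjective _ (Ideal.Quotient.factor_surjective (hle j))
  -- the cardinality of `M / J M`
  obtain ⟨b, hb1, hb2, hQ⟩ : ∃ b, 1 ≤ b ∧ b ≤ B ∧
      Nat.card (((Π i : Fin m, PowerSeries ℤ_[p] ⧸
            Ideal.span {(p : PowerSeries ℤ_[p]) ^ (α i)}) ×
          (Π j : Fin k, PowerSeries ℤ_[p] ⧸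
            Ideal.span {(η j) ^ (β j)})) ⧸ (J • (⊤ : Submodule (PowerSeries ℤ_[p]) _))) =
        p ^ (p ^ n * S) * b := by
    refine ⟨∏ j : Fin k, Nat.card (PowerSeries ℤ_[p] ⧸ (Ideal.span {(η j) ^ (β j)} ⊔ J)),
      ?_, ?_, ?_⟩
    · exact Finset.prod_pos fun j _ => Nat.card_pos
    · refine Finset.prod_le_prod' fun j _ => ?_
      exact Nat.card_le_card_of_surjective _ (Ideal.Quotient.factor_surjective (hle j))
    · rw [← Nat.card_congr (TensorProduct.quotTensorEquivQuotSMul _ J).toEquiv,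
        Nat.card_congr (TensorProduct.prodRight (PowerSeries ℤ_[p]) (PowerSeries ℤ_[p]) _ _ _).toEquiv,
        Nat.card_prod,
        Nat.card_congr (TensorProduct.piRight (PowerSeries ℤ_[p]) (PowerSeries ℤ_[p]) _ _).toEquiv,
        Nat.card_congr (TensorProduct.piRight (PowerSeries ℤ_[p]) (PowerSeries ℤ_[p]) _ _).toEquiv,
        Nat.card_pi, Nat.card_pi]
      simp only [card_tensor_quot]
      congr 1
      rw [hS, Finset.mul_sum, ← Finset.prod_pow_eq_pow_sum]
      refine Finset.prod_congr rfl fun i _ => ?_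
      have hI : Ideal.span {(p : PowerSeries ℤ_[p]) ^ (α i)} ⊔ J =
          Ideal.span {(p : PowerSeries ℤ_[p]) ^ (min ν (α i)), ω} := by
        apply le_antisymm
        · refine sup_le ?_ ?_
          · rw [Ideal.span_singleton_le_iff_mem]
            exact Ideal.mem_of_dvd _ (pow_dvd_pow _ (min_le_right ν (α i)))
              (Ideal.subset_span (by simp))
          · rw [hJ, Ideal.span_le]
            rintro x (rfl | rfl)
            · exact Ideal.mem_of_dvd _ (pow_dvd_pow _ (min_le_left ν (α i)))
                (Ideal.subset_span (by simp))
            · exact Ideal.subset_span (by simp)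
        · rw [Ideal.span_le]
          rintro x (rfl | rfl)
          · rcases min_choice ν (α i) with h | h
            · rw [h]
              exact Ideal.mem_sup_right (Ideal.subset_span (by simp))
            · rw [h]
              exact Ideal.mem_sup_left (Ideal.subset_span (by simp))
          · exact Ideal.mem_sup_right (Ideal.subset_span (by simp))
      rw [hI, card_basic, hω, map_omega, order_X_pow, ENat.toNat_natCast, mul_comm]
      rw [hω, map_omega]
      exact pow_ne_zero _ X_ne_zero
  rw [hQ] at hD
  have hcard : Nat.card (Z ⧸ (J • (⊤ : Submodule (PowerSeries ℤ_[p]) Z))) ≠ 0 := by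
    intro h0
    rw [h0, mul_zero] at hD
    have : 0 < p ^ (p ^ n * S) * b * N := by
      have := hp.pos
      positivity
    omega
  have : Finite (Z ⧸ (J • (⊤ : Submodule (PowerSeries ℤ_[p]) Z))) :=
    Nat.finite_of_card_ne_zero hcard
  obtain ⟨e, he⟩ : ∃ e, Nat.card (Z ⧸ (J • (⊤ : Submodule (PowerSeries ℤ_[p]) Z))) = p ^ e := by
    have hP : IsPGroup p (Multiplicative (Z ⧸ (J • (⊤ : Submodule (PowerSeries ℤ_[p]) Z)))) := by
      intro g
      refine ⟨ν, ?_⟩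
      obtain ⟨z, hz⟩ := Submodule.Quotient.mk_surjective _ (Multiplicative.toAdd g)
      apply Multiplicative.toAdd.injective
      rw [toAdd_pow, ← hz, toAdd_one, ← Nat.cast_smul_eq_nsmul (PowerSeries ℤ_[p]),
        ← Submodule.Quotient.mk_smul, Submodule.Quotient.mk_eq_zero]
      refine Submodule.smul_mem_smul (Ideal.subset_span ?_) trivial
      simp
    obtain ⟨e, he⟩ := IsPGroup.iff_card.1 hP
    exact ⟨e, he⟩
  refine ⟨e, he, ?_⟩
  rw [he] at hD
  have hx : ∀ x : ℕ, x ≤ p ^ x := fun x => (Nat.lt_pow_self hp.one_lt).le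
  have u1 : e ≤ p ^ n * S + B * N := by
    rw [← Nat.pow_le_pow_iff_right hp.one_lt, pow_add]
    calc p ^ e ≤ D * p ^ e := Nat.le_mul_of_pos_left _ hD1
      _ = p ^ (p ^ n * S) * (b * N) := by rw [hD, mul_assoc]
      _ ≤ p ^ (p ^ n * S) * (B * N) := by gcongr
      _ ≤ _ := by gcongr; exact hx _
  have u2 : p ^ n * S ≤ e + N ^ 2 := by
    rw [← Nat.pow_le_pow_iff_right hp.one_lt, pow_add]
    calc p ^ (p ^ n * S) ≤ p ^ (p ^ n * S) * (b * N) :=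
          Nat.le_mul_of_pos_right _ (Nat.mul_pos hb1 hNpos)
      _ = D * p ^ e := by rw [hD, mul_assoc]
      _ ≤ N ^ 2 * p ^ e := by gcongr
      _ ≤ p ^ e * p ^ (N ^ 2) := by rw [mul_comm]; exact Nat.mul_le_mul_left _ (hx _)
  have hcast : (p : ℤ) ^ n * (∑ i : Fin m, (min ν (α i) : ℤ)) = ((p ^ n * S : ℕ) : ℤ) := by
    rw [hS]; push_cast; rfl
  rw [hcast, abs_le]
  generalize p ^ n * S = q at *
  generalize B * N = q1 at *
  generalize N ^ 2 = q2 at *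
  constructor <;> push_cast <;> omega
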